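/- arXiv:0706.4053 — 2 statements merged into one kernel-verified Lean document; each statement's English description precedes it below -/
import Mathlib

section
/- Let α ∈ ℝ be irrational and satisfy the Diophantine condition |m + nα| ≥ C/|n|^τ for all n ≠ 0, m ∈ ℤ. Then the rotation R_α on 𝕋¹ is cohomology-free in the following sense: for every smooth χ : 𝕋¹ → ℝ there exists a smooth ζ : 𝕋¹ → ℝ with ζ(x + α) − ζ(x) = χ(x) − ∫_{𝕋¹} χ dLeb for all x ∈ 𝕋¹. -/
noncomputable def dioE (n : ℤ) (x : ℝ) : ℂ := Complex.exp (2 * Real.pi * Complex.I * n * x)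

noncomputable def dioC (f : ℝ → ℂ) (n : ℤ) : ℂ := ∫ t in (0:ℝ)..1, dioE (-n) t * f t

lemma dioE_norm (n : ℤ) (x : ℝ) : ‖dioE n x‖ = 1 := by
  unfold dioE
  rw [Complex.norm_exp]
  simp

lemma dioE_fourier (n : ℤ) (x : ℝ) : fourier n (x : AddCircle (1:ℝ)) = dioE n x := by
  rw [fourier_coe_apply]; simp [dioE]

lemma dioE_add (n : ℤ) (x y : ℝ) : dioE n (x + y) = dioE n x * dioE n y := by
  unfold dioE
  rw [← Complex.exp_add]; push_cast; ring_nf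

lemma dioE_one (n : ℤ) : dioE n 1 = 1 := by
  unfold dioE
  rw [← Complex.exp_int_mul_two_pi_mul_I n]; congr 1; push_cast; ring

lemma dioE_hasDerivAt (n : ℤ) (x : ℝ) :
    HasDerivAt (dioE n) ((2 * Real.pi * Complex.I * n) * dioE n x) x := by
  unfold dioE
  have h : HasDerivAt (fun x : ℝ => (2 * Real.pi * Complex.I * n) * (x : ℂ))
      (2 * Real.pi * Complex.I * n) x := by
    simpa using (Complex.ofRealCLM.hasDerivAt (x := x)).const_mul (2 * Real.pi * Complex.I * n)
  simpa [mul_comm] using h.cexp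

lemma dioE_contDiff (n : ℤ) : ContDiff ℝ (⊤ : ℕ∞) (dioE n) := by
  unfold dioE
  exact (contDiff_const.mul Complex.ofRealCLM.contDiff).cexp

lemma dioE_iter (n : ℤ) (a : ℂ) (k : ℕ) :
    iteratedDeriv k (fun x => a * dioE n x)
      = fun x => a * (2 * Real.pi * Complex.I * n) ^ k * dioE n x := by
  induction k with
  | zero => simp
  | succ k ih =>
    rw [iteratedDeriv_succ, ih]
    funext x
    rw [((dioE_hasDerivAt n x).const_mul _).deriv]
    ring

lemma dioC_eq (f : ℝ → ℂ) (n : ℤ) :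
    dioC f n = fourierCoeffOn (zero_lt_one : (0:ℝ) < 1) f n := by
  rw [fourierCoeffOn_eq_integral]
  simp only [dioC, dioE, fourier_coe_apply, smul_eq_mul]
  simp

lemma dioC_bound (k : ℕ) : ∀ f : ℝ → ℂ, ContDiff ℝ (⊤ : ℕ∞) f → Function.Periodic f 1 →
    ∃ M : ℝ, 0 ≤ M ∧ ∀ n : ℤ, |(n:ℝ)| ^ k * ‖dioC f n‖ ≤ M := by
  induction k with
  | zero =>
    intro f hf hp
    refine ⟨∫ t in (0:ℝ)..1, ‖f t‖,
      intervalIntegral.integral_nonneg zero_le_one fun _ _ => norm_nonneg _, fun n => ?_⟩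
    have := intervalIntegral.norm_integral_le_integral_norm (μ := MeasureTheory.volume)
      (f := fun t => dioE (-n) t * f t) (zero_le_one : (0:ℝ) ≤ 1)
    simpa [dioC, dioE_norm] using this
  | succ k ih =>
    intro f hf hp
    have hf' := contDiff_infty_iff_deriv.1 hf
    have hp' : Function.Periodic (deriv f) 1 := by
      intro x
      rw [← deriv_comp_add_const]
      congr 1
      exact funext hp
    obtain ⟨M, hM0, hM⟩ := ih (deriv f) hf'.2 hp'
    refine ⟨M, hM0, fun n => ?_⟩
    rcases eq_or_ne n 0 with rfl | hn
    · simpa using hM0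
    have h := fourierCoeffOn_of_hasDerivAt (zero_lt_one : (0:ℝ) < 1) (f := f) (f' := deriv f) hn
      (fun x _ => (hf'.1 x).hasDerivAt) (hf'.2.continuous.intervalIntegrable _ _)
    rw [← dioC_eq, ← dioC_eq, show f 1 = f 0 by simpa using hp 0] at h
    have h2 : ‖dioC f n‖ = 1 / (2 * Real.pi * |(n:ℝ)|) * ‖dioC (deriv f) n‖ := by
      rw [h]
      simp [abs_of_pos Real.pi_pos]
    have hn' : 0 < |(n:ℝ)| := by positivity
    have : |(n:ℝ)| ^ (k+1) * ‖dioC f n‖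
        = 1 / (2 * Real.pi) * (|(n:ℝ)| ^ k * ‖dioC (deriv f) n‖) := by
      rw [h2]; field_simp; ring
    rw [this]
    have hpi : 1 / (2 * Real.pi) ≤ 1 := by
      rw [div_le_one (by positivity)]; linarith [Real.pi_gt_three]
    calc _ ≤ 1 * (|(n:ℝ)| ^ k * ‖dioC (deriv f) n‖) := by gcongr
      _ ≤ M := by simpa using hM n

lemma dio_summable_of {b : ℤ → ℂ} {M : ℝ} (k : ℕ) (h0 : b 0 = 0)
    (h : ∀ n : ℤ, |(n:ℝ)| ^ (k + 2) * ‖b n‖ ≤ M) :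
    Summable fun n : ℤ => |(n:ℝ)| ^ k * ‖b n‖ := by
  refine Summable.of_nonneg_of_le (fun n => by positivity) (fun n => ?_)
    ((Real.summable_one_div_int_pow (p := 2)).2 one_lt_two |>.mul_left M)
  rcases eq_or_ne n 0 with rfl | hn
  · simp [h0]
  have hn' : 0 < |(n:ℝ)| := by positivity
  rw [← sq_abs, mul_one_div, le_div_iff₀ (by positivity)]
  calc _ = |(n:ℝ)| ^ (k + 2) * ‖b n‖ := by ring
    _ ≤ M := h n

lemma dio_smooth {a : ℤ → ℂ} (h : ∀ k : ℕ, Summable fun n : ℤ => |(n:ℝ)| ^ k * ‖a n‖) :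
    ContDiff ℝ (⊤ : ℕ∞) fun x => ∑' n, a n * dioE n x := by
  refine contDiff_tsum (v := fun k (n : ℤ) => (2 * Real.pi) ^ k * (|(n:ℝ)| ^ k * ‖a n‖))
    (fun n => contDiff_const.mul (dioE_contDiff n)) (fun k _ => (h k).mul_left _) ?_
  intro k n x _
  rw [norm_iteratedFDeriv_eq_norm_iteratedDeriv, dioE_iter]
  simp only [norm_mul, norm_pow, dioE_norm]
  simp [abs_of_pos Real.pi_pos]
  apply le_of_eq; ring

lemma dio_hasSum {f : ℝ → ℂ} (hf : Continuous f) (hp : Function.Periodic f 1)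
    (hs : Summable (dioC f)) (x : ℝ) : HasSum (fun n => dioC f n * dioE n x) (f x) := by
  have hc : Continuous (hp.lift : AddCircle (1:ℝ) → ℂ) := continuous_coinduced_dom.mpr hf
  let F : C(AddCircle (1:ℝ), ℂ) := ⟨hp.lift, hc⟩
  have hF : ∀ n, fourierCoeff F n = dioC f n := by
    intro n
    rw [fourierCoeff_eq_intervalIntegral _ _ 0]
    simp only [dioE_fourier, dioC]
    simp [F]
  have := has_pointwise_sum_fourier_series_of_summable (f := F)
    (by rw [show fourierCoeff F = dioC f from funext hF]; exact hs) (x : AddCircle (1:ℝ))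
  simp only [hF, dioE_fourier, smul_eq_mul] at this
  exact this

lemma dio_lower (n : ℤ) (α : ℝ) : ∃ m : ℤ, 4 * |(m:ℝ) + n * α| ≤ ‖dioE n α - 1‖ := by
  refine ⟨-round (n * α), ?_⟩
  set m := round (n * α) with hm
  have h1 : |(n:ℝ) * α - m| ≤ 1 / 2 := abs_sub_round _
  have h2 : dioE n α = Complex.exp (Complex.I * ((2 * Real.pi * (n * α - m) : ℝ) : ℂ)) := by
    unfold dioE
    rw [Complex.exp_eq_exp_iff_exists_int]
    refine ⟨m, ?_⟩
    push_cast; ring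
  rw [h2, Complex.norm_exp_I_mul_ofReal_sub_one]
  have h3 : |Real.pi * (n * α - m)| ≤ Real.pi / 2 := by
    rw [abs_mul, abs_of_pos Real.pi_pos]
    nlinarith [Real.pi_pos]
  have h4 := Real.mul_abs_le_abs_sin h3
  rw [abs_mul, abs_of_pos Real.pi_pos] at h4
  rw [show 2 * Real.pi * (n * α - m) / 2 = Real.pi * (n * α - m) by ring, norm_mul,
    Real.norm_eq_abs, Real.norm_eq_abs, abs_two]
  have h5 : 2 / Real.pi * (Real.pi * |(n:ℝ) * α - m|) = 2 * |(n:ℝ) * α - m| := by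
    field_simp
  rw [h5] at h4
  rw [show ((-m : ℤ):ℝ) + n * α = n * α - m by push_cast; ring]
  linarith


theorem diophantine_rotation_cohomology_free (α : ℝ) (hirr : Irrational α)
    (hdio : ∃ C τ : ℝ, 0 < C ∧ 0 < τ ∧
      ∀ n : ℤ, n ≠ 0 → ∀ m : ℤ, C / |(n : ℝ)| ^ τ ≤ |(m : ℝ) + (n : ℝ) * α|)
    (χ : ℝ → ℝ) (hχ : ContDiff ℝ (⊤ : ℕ∞) χ) (hper : Function.Periodic χ 1) :
    ∃ ζ : ℝ → ℝ, ContDiff ℝ (⊤ : ℕ∞) ζ ∧ Function.Periodic ζ 1 ∧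
      ∀ x : ℝ, ζ (x + α) - ζ x = χ x - ∫ t in (0:ℝ)..1, χ t := by
  obtain ⟨C, τ, hC, hτ, hd⟩ := hdio
  set f : ℝ → ℂ := fun x => (χ x : ℂ) with hfdef
  have hf : ContDiff ℝ (⊤ : ℕ∞) f := Complex.ofRealCLM.contDiff.comp hχ
  have hp : Function.Periodic f 1 := fun x => by simp [hfdef, hper x]
  obtain ⟨N, hN⟩ := exists_nat_ge τ
  have hlow : ∀ n : ℤ, n ≠ 0 → 4 * C / |(n:ℝ)| ^ N ≤ ‖dioE n α - 1‖ := by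
    intro n hn
    obtain ⟨m, hm⟩ := dio_lower n α
    have h1 : 1 ≤ |(n:ℝ)| := by exact_mod_cast Int.one_le_abs hn
    have h2 : |(n:ℝ)| ^ τ ≤ |(n:ℝ)| ^ N := by
      rw [← Real.rpow_natCast]; exact Real.rpow_le_rpow_of_exponent_le h1 hN
    have h3 : 0 < |(n:ℝ)| ^ τ := by positivity
    have h4 : C / |(n:ℝ)| ^ N ≤ C / |(n:ℝ)| ^ τ := by gcongr
    rw [mul_div_assoc]
    linarith [hd n hn m]
  set a : ℤ → ℂ := fun n => dioC f n / (dioE n α - 1) with ha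
  have ha0 : a 0 = 0 := by simp [ha, dioE]
  have haS : ∀ k : ℕ, Summable fun n : ℤ => |(n:ℝ)| ^ k * ‖a n‖ := by
    intro k
    obtain ⟨M, hM0, hM⟩ := dioC_bound (k + 2 + N) f hf hp
    refine dio_summable_of (M := M / (4 * C)) k ha0 fun n => ?_
    rcases eq_or_ne n 0 with rfl | hn
    · rw [ha0]; simp; positivity
    have hn' : 0 < |(n:ℝ)| := by positivity
    have hl := hlow n hn
    have hpos : 0 < 4 * C / |(n:ℝ)| ^ N := by positivity
    simp only [ha, norm_div]
    calc |(n:ℝ)| ^ (k + 2) * (‖dioC f n‖ / ‖dioE n α - 1‖)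
        ≤ |(n:ℝ)| ^ (k + 2) * (‖dioC f n‖ / (4 * C / |(n:ℝ)| ^ N)) := by gcongr
      _ = |(n:ℝ)| ^ (k + 2 + N) * ‖dioC f n‖ / (4 * C) := by field_simp; ring
      _ ≤ M / (4 * C) := by gcongr; exact hM n
  have haS0 : ∀ x, Summable fun n => a n * dioE n x := by
    intro x
    apply Summable.of_norm
    simpa [dioE_norm] using haS 0
  have hcS : Summable (dioC f) := by
    obtain ⟨M, hM0, hM⟩ := dioC_bound 2 f hf hp
    have h1 : Summable fun n : ℤ => ‖dioC f n - Pi.single (M := fun _ => ℂ) 0 (dioC f 0) n‖ := by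
      have := dio_summable_of (b := fun n => dioC f n - Pi.single (M := fun _ => ℂ) 0 (dioC f 0) n)
        (M := M) 0 (by simp) (fun n => ?_)
      · simpa using this
      rcases eq_or_ne n 0 with rfl | hn
      · simpa using hM0
      · simpa [hn] using hM n
    have h2 := h1.of_norm.add (hasSum_pi_single (0:ℤ) (dioC f 0)).summable
    simpa using h2
  have hF := dio_hasSum hf.continuous hp hcS
  have hc0 : dioC f 0 = ((∫ t in (0:ℝ)..1, χ t : ℝ) : ℂ) := by
    simp [dioC, dioE, hfdef, intervalIntegral.integral_ofReal]
  have hne : ∀ n : ℤ, n ≠ 0 → dioE n α - 1 ≠ 0 := by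
    intro n hn h
    have := hlow n hn
    rw [h, norm_zero] at this
    have hn' : 0 < |(n:ℝ)| := by positivity
    have hpos : 0 < 4 * C / |(n:ℝ)| ^ N := by positivity
    linarith
  refine ⟨fun x => (∑' n, a n * dioE n x).re, Complex.reCLM.contDiff.comp (dio_smooth haS), ?_, ?_⟩
  · intro x
    simp [dioE_add, dioE_one]
  · intro x
    have h1 := (haS0 (x + α)).hasSum.sub (haS0 x).hasSum
    have h2 := (hF x).sub (hasSum_pi_single (0:ℤ) (dioC f 0))
    have h3 : (fun n => a n * dioE n (x + α) - a n * dioE n x)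
        = fun n => dioC f n * dioE n x - Pi.single (M := fun _ => ℂ) 0 (dioC f 0) n := by
      funext n
      rcases eq_or_ne n 0 with rfl | hn
      · simp [ha0, dioE]
      · have := hne n hn
        simp only [dioE_add, ha, Pi.single_eq_of_ne hn]
        field_simp
        ring
    rw [h3] at h1
    have h4 := congrArg Complex.re (h1.unique h2)
    rw [hc0] at h4
    simpa [hfdef] using h4
end

section
/- Let α ∈ ℝᵈ be a Diophantine vector. For every smooth ξ : 𝕋ᵈ → ℝ there exists a smooth u : 𝕋ᵈ → ℝ such that the directional derivative of u along the constant vector field α equals ξ minus its mean: ∑ᵢ αᵢ ∂u/∂θᵢ = ξ − ∫_{𝕋ᵈ} ξ dLeb. -/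
open MeasureTheory

namespace DioFlow

variable {d : ℕ}

noncomputable def kc (k : Fin d → ℤ) : Fin d → ℝ := fun i => (k i : ℝ)

noncomputable def Lk (k : Fin d → ℤ) : (Fin d → ℝ) →L[ℝ] ℝ :=
  ∑ i, (k i : ℝ) • ContinuousLinearMap.proj i

lemma Lk_apply (k : Fin d → ℤ) (x : Fin d → ℝ) : Lk k x = ∑ i, (k i : ℝ) * x i := by
  simp [Lk]

noncomputable def ex (t : ℝ) : ℂ := Complex.exp (2 * Real.pi * Complex.I * t)

lemma hasDerivAt_ex (t : ℝ) : HasDerivAt ex (2 * Real.pi * Complex.I * ex t) t := by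
  have h1 : HasDerivAt (fun t : ℝ => 2 * Real.pi * Complex.I * (t : ℂ))
      (2 * Real.pi * Complex.I * 1) t :=
    (Complex.ofRealCLM.hasDerivAt (x := t)).const_mul _
  have := h1.cexp
  unfold ex
  convert! this using 1
  ring

lemma norm_ex (t : ℝ) : ‖ex t‖ = 1 := by
  have : ex t = Complex.exp (((2 * Real.pi * t : ℝ) : ℂ) * Complex.I) := by
    unfold ex; congr 1; push_cast; ring
  rw [this, Complex.norm_exp_ofReal_mul_I]

lemma contDiff_ex : ContDiff ℝ (⊤ : ℕ∞) ex := by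
  unfold ex
  exact (contDiff_const.mul Complex.ofRealCLM.contDiff).cexp

lemma ex_int (n : ℤ) : ex n = 1 := by
  rw [ex, Complex.exp_eq_one_iff]
  exact ⟨n, by push_cast; ring⟩

lemma ex_add (s t : ℝ) : ex (s + t) = ex s * ex t := by
  simp only [ex, ← Complex.exp_add]; congr 1; push_cast; ring

lemma iteratedDeriv_ex (n : ℕ) :
    iteratedDeriv n ex = fun t => (2 * Real.pi * Complex.I) ^ n * ex t := by
  induction n with
  | zero => simp
  | succ n ih =>
    rw [iteratedDeriv_succ, ih]
    ext t
    rw [((hasDerivAt_ex t).const_mul _).deriv]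
    ring

noncomputable def ch (k : Fin d → ℤ) (x : Fin d → ℝ) : ℂ := ex (Lk k x)

lemma norm_ch (k : Fin d → ℤ) (x : Fin d → ℝ) : ‖ch k x‖ = 1 := norm_ex _

lemma contDiff_ch (k : Fin d → ℤ) : ContDiff ℝ (⊤ : ℕ∞) (ch k) :=
  contDiff_ex.comp (Lk k).contDiff

lemma ch_zero (x : Fin d → ℝ) : ch 0 x = 1 := by
  simp [ch, ex, Lk_apply]

lemma ch_periodic (k : Fin d → ℤ) (x : Fin d → ℝ) (m : Fin d → ℤ) :
    ch k (x + fun i => (m i : ℝ)) = ch k x := by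
  have : Lk k (fun i => (m i : ℝ)) = ((∑ i, k i * m i : ℤ) : ℝ) := by
    rw [Lk_apply]; push_cast; rfl
  rw [ch, map_add, ex_add, this, ex_int, mul_one, ch]

lemma hasFDerivAt_ch (k : Fin d → ℤ) (x : Fin d → ℝ) :
    HasFDerivAt (ch k) ((Lk k).smulRight (2 * Real.pi * Complex.I * ch k x)) x := by
  have := (hasDerivAt_ex (Lk k x)).hasFDerivAt.comp x (Lk k).hasFDerivAt
  convert! this using 1

lemma norm_iter_ch (k : Fin d → ℤ) (n : ℕ) (x : Fin d → ℝ) :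
    ‖iteratedFDeriv ℝ n (ch k) x‖ ≤ (2 * Real.pi) ^ n * ‖Lk k‖ ^ n := by
  have h := (Lk k).iteratedFDeriv_comp_right (contDiff_ex) x (i := n) (by exact_mod_cast le_top)
  have h2 : iteratedFDeriv ℝ n (ch k) x = _ := h
  rw [h2]
  refine (ContinuousMultilinearMap.norm_compContinuousLinearMap_le _ _).trans ?_
  rw [norm_iteratedFDeriv_eq_norm_iteratedDeriv, iteratedDeriv_ex]
  simp [norm_ex, abs_of_pos Real.pi_pos]

lemma norm_Lk (k : Fin d → ℤ) : ‖Lk k‖ ≤ d * ‖kc k‖ := by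
  refine ContinuousLinearMap.opNorm_le_bound _ (by positivity) fun x => ?_
  rw [Lk_apply]
  refine (norm_sum_le _ _).trans ?_
  have : ∀ i ∈ Finset.univ, ‖(k i : ℝ) * x i‖ ≤ ‖kc k‖ * ‖x‖ := by
    intro i _
    rw [norm_mul]
    exact mul_le_mul (norm_le_pi_norm (kc k) i) (norm_le_pi_norm x i) (norm_nonneg _) (norm_nonneg _)
  refine (Finset.sum_le_sum this).trans ?_
  simp [mul_assoc]

def Per (F : (Fin d → ℝ) → ℂ) : Prop :=
  ∀ (x : Fin d → ℝ) (k : Fin d → ℤ), F (x + fun i => (k i : ℝ)) = F x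

def box (a : Fin d → ℝ) : Set (Fin d → ℝ) := {x | ∀ i, x i ∈ Set.Ioc (a i) (a i + 1)}

def tor (x : Fin d → ℝ) : UnitAddTorus (Fin d) := fun i => (x i : UnitAddCircle)

noncomputable def desc (F : (Fin d → ℝ) → ℂ) (t : UnitAddTorus (Fin d)) : ℂ :=
  F fun i => Quotient.out (t i)

lemma desc_tor {F : (Fin d → ℝ) → ℂ} (hF : Per F) (x : Fin d → ℝ) : desc F (tor x) = F x := by
  have : ∀ i, ∃ n : ℤ, Quotient.out (tor x i) = x i + n := by
    intro i
    have h : ((Quotient.out (tor x i) : ℝ) : UnitAddCircle) = (x i : UnitAddCircle) :=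
      Quotient.out_eq (tor x i)
    have h' := (QuotientAddGroup.eq.1 h.symm)
    rw [AddSubgroup.mem_zmultiples_iff] at h'
    obtain ⟨n, hn⟩ := h'
    refine ⟨n, ?_⟩
    simp only [zsmul_eq_mul, mul_one] at hn
    rw [hn]; ring
  choose n hn using this
  rw [← hF x n, desc]
  congr 1
  ext i
  exact hn i

lemma tor_quot : IsOpenQuotientMap (tor (d := d)) := by
  have : ∀ i : Fin d, IsOpenQuotientMap (fun x : ℝ => (x : UnitAddCircle)) := fun i =>
    QuotientAddGroup.isOpenQuotientMap_mk
  exact IsOpenQuotientMap.piMap this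

lemma continuous_desc {F : (Fin d → ℝ) → ℂ} (hF : Per F) (hc : Continuous F) :
    Continuous (desc F) := by
  rw [tor_quot.isQuotientMap.continuous_iff]
  convert! hc using 1
  ext x
  exact desc_tor hF x

lemma mFourier_tor (k : Fin d → ℤ) (x : Fin d → ℝ) :
    UnitAddTorus.mFourier k (tor x) = ch k x := by
  simp only [UnitAddTorus.mFourier, tor, ContinuousMap.coe_mk, ch, Lk_apply, ex]
  rw [Finset.prod_congr rfl (fun i _ => fourier_coe_apply), ← Complex.exp_sum]
  congr 1
  push_cast
  rw [Finset.mul_sum]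
  refine Finset.sum_congr rfl fun i _ => ?_
  ring_nf

noncomputable def cf (g : (Fin d → ℝ) → ℂ) (k : Fin d → ℤ) : ℂ :=
  ∫ x in box 0, ch (-k) x * g x

lemma coeff_desc {g : (Fin d → ℝ) → ℂ} (hg : Per g) (k : Fin d → ℤ) (a : Fin d → ℝ) :
    UnitAddTorus.mFourierCoeff (desc g) k = ∫ x in box a, ch (-k) x * g x := by
  rw [UnitAddTorus.mFourierCoeff_eq_integral _ _ a]
  refine integral_congr_ae (Filter.Eventually.of_forall fun x => ?_)
  show UnitAddTorus.mFourier (-k) (tor x) • desc g (tor x) = _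
  rw [mFourier_tor, desc_tor hg, smul_eq_mul]

lemma hasSum_cf {g : (Fin d → ℝ) → ℂ} (hg : Per g) (hc : Continuous g)
    (hs : Summable (cf g)) (x : Fin d → ℝ) : HasSum (fun k => cf g k * ch k x) (g x) := by
  have e : UnitAddTorus.mFourierCoeff (desc g) = cf g := by
    ext k; exact coeff_desc hg k 0
  have := UnitAddTorus.hasSum_mFourier_series_apply_of_summable
    (f := ⟨desc g, continuous_desc hg hc⟩) (by
      show Summable (UnitAddTorus.mFourierCoeff (desc g)); rwa [e]) (tor x)
  simp only [ContinuousMap.coe_mk, mFourier_tor, desc_tor hg, e, smul_eq_mul] at this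
  exact this

lemma meas_box (a : Fin d → ℝ) : MeasurableSet (box a) :=
  MeasurableSet.univ_pi' (fun i => measurableSet_Ioc (a := a i))

lemma integral_shift {F : (Fin d → ℝ) → ℂ} (hF : Per F) (a : Fin d → ℝ) :
    ∫ x in box 0, F (x + a) = ∫ x in box 0, F x := by
  have h0 := coeff_desc hF 0 0
  rw [coeff_desc hF 0 a] at h0
  simp only [neg_zero, ch_zero, one_mul] at h0
  rw [← h0]
  have hp : (fun x => x + a) ⁻¹' (box a) = box (0 : Fin d → ℝ) := by
    ext x
    simp only [box, Set.mem_preimage, Set.mem_ofPred_eq, Set.mem_Ioc, Pi.add_apply, Pi.zero_apply]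
    refine forall_congr' fun i => ?_
    constructor <;> rintro ⟨h1, h2⟩ <;> constructor <;> linarith
  rw [← hp]
  exact (measurePreserving_add_right volume a).setIntegral_preimage_emb
    (measurableEmbedding_addRight a) F (box a)

lemma box_sub : box (0 : Fin d → ℝ) ⊆ Metric.closedBall 0 1 := by
  intro x hx
  rw [mem_closedBall_zero_iff, pi_norm_le_iff_of_nonneg zero_le_one]
  intro i
  have := hx i
  simp only [Pi.zero_apply, Set.mem_Ioc, zero_add] at this
  rw [Real.norm_eq_abs, abs_of_pos this.1]
  exact this.2

lemma box_fin : volume (box (0 : Fin d → ℝ)) < ⊤ :=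
  (measure_mono box_sub).trans_lt measure_closedBall_lt_top

lemma integrable_box {F : (Fin d → ℝ) → ℂ} (hF : Continuous F) :
    IntegrableOn F (box 0) :=
  (hF.continuousOn.integrableOn_compact (isCompact_closedBall 0 1)).mono_set box_sub

lemma integral_fderiv {F : (Fin d → ℝ) → ℂ} (hF : Per F) (hd : ContDiff ℝ (⊤ : ℕ∞) F)
    (v : Fin d → ℝ) : ∫ x in box 0, fderiv ℝ F x v = 0 := by
  have hcont : Continuous fun x => fderiv ℝ F x v :=
    (hd.continuous_fderiv (by simp)).clm_apply continuous_const
  obtain ⟨M, hM⟩ := (isCompact_closedBall (0 : Fin d → ℝ) (1 + ‖v‖)).exists_bound_of_continuousOn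
    hcont.continuousOn
  have key := hasDerivAt_integral_of_dominated_loc_of_deriv_le (𝕜 := ℝ)
    (μ := volume.restrict (box (0 : Fin d → ℝ))) (F := fun (t : ℝ) x => F (x + t • v))
    (F' := fun t x => fderiv ℝ F (x + t • v) v) (x₀ := 0) (bound := fun _ => M)
    (Metric.ball_mem_nhds (0 : ℝ) one_pos)
    (Filter.Eventually.of_forall fun t =>
      (hd.continuous.comp (by fun_prop)).aestronglyMeasurable)
    (by simpa using! integrable_box hd.continuous)
    (by simpa using hcont.aestronglyMeasurable)
    (by
      refine (ae_restrict_iff' (meas_box 0)).2 (Filter.Eventually.of_forall fun x hx t ht => ?_)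
      apply hM
      rw [mem_closedBall_zero_iff]
      have h1 := box_sub hx
      rw [mem_closedBall_zero_iff] at h1
      rw [mem_ball_zero_iff] at ht
      refine (norm_add_le _ _).trans (add_le_add h1 ?_)
      rw [norm_smul]
      exact mul_le_of_le_one_left (norm_nonneg _) ht.le)
    (integrableOn_const (hs := box_fin.ne))
    (by
      refine Filter.Eventually.of_forall fun x t _ => ?_
      have h1 : HasDerivAt (fun t : ℝ => x + t • v) v t := by
        simpa using ((hasDerivAt_id t).smul_const v).const_add x
      exact ((hd.differentiable (by simp)) _).hasFDerivAt.comp_hasDerivAt t h1)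
  have h2 := key.2
  simp only [integral_shift hF, zero_smul, add_zero] at h2
  exact h2.unique (hasDerivAt_const _ _)

lemma per_fderiv {g : (Fin d → ℝ) → ℂ} (hg : Per g) (v : Fin d → ℝ) :
    Per (fun x => fderiv ℝ g x v) := by
  intro x k
  have : (fun y => g (y + fun i => (k i : ℝ))) = g := by ext y; exact hg y k
  show fderiv ℝ g (x + fun i => (k i : ℝ)) v = _
  rw [← fderiv_comp_add_right, this]

lemma contDiff_dir {g : (Fin d → ℝ) → ℂ} (hd : ContDiff ℝ (⊤ : ℕ∞) g) (v : Fin d → ℝ) :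
    ContDiff ℝ (⊤ : ℕ∞) (fun x => fderiv ℝ g x v) :=
  (hd.fderiv_right (m := (⊤ : ℕ∞)) (by simp)).clm_apply contDiff_const

lemma cf_fderiv {g : (Fin d → ℝ) → ℂ} (hg : Per g) (hd : ContDiff ℝ (⊤ : ℕ∞) g)
    (v : Fin d → ℝ) (k : Fin d → ℤ) :
    cf (fun x => fderiv ℝ g x v) k = 2 * Real.pi * Complex.I * (Lk k v) * cf g k := by
  have hP : Per (fun x => ch (-k) x * g x) := by
    intro x m
    show ch (-k) _ * g _ = _
    rw [ch_periodic, hg]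
  have h0 := integral_fderiv hP ((contDiff_ch (-k)).mul hd) v
  have hL : Lk (-k) v = - Lk k v := by simp [Lk_apply]
  have e : ∀ x, fderiv ℝ (fun x => ch (-k) x * g x) x v =
      ch (-k) x * fderiv ℝ g x v - 2 * Real.pi * Complex.I * (Lk k v) * (ch (-k) x * g x) := by
    intro x
    have hm : HasFDerivAt (fun x => ch (-k) x * g x) _ x :=
      (hasFDerivAt_ch (-k) x).mul ((hd.differentiable (by simp)) x).hasFDerivAt
    rw [hm.fderiv]
    simp [hL]
    ring
  simp only [e] at h0
  rw [integral_sub, integral_const_mul, sub_eq_zero] at h0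
  · exact h0
  · exact integrable_box ((contDiff_ch (-k)).continuous.mul (contDiff_dir hd v).continuous)
  · exact (integrable_box ((contDiff_ch (-k)).continuous.mul hd.continuous)).const_mul _

lemma decay1 (j : Fin d) (N : ℕ) : ∀ {g : (Fin d → ℝ) → ℂ}, Per g → ContDiff ℝ (⊤ : ℕ∞) g →
    ∃ M : ℝ, ∀ k : Fin d → ℤ, |(k j : ℝ)| ^ N * ‖cf g k‖ ≤ M := by
  induction N with
  | zero =>
    intro g hg hd
    obtain ⟨M, hM⟩ := (isCompact_closedBall (0 : Fin d → ℝ) 1).exists_bound_of_continuousOn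
      hd.continuous.continuousOn
    refine ⟨M * volume.real (box (0 : Fin d → ℝ)), fun k => ?_⟩
    rw [pow_zero, one_mul]
    refine norm_setIntegral_le_of_norm_le_const box_fin fun x hx => ?_
    rw [norm_mul, norm_ch, one_mul]
    exact hM x (box_sub hx)
  | succ N ih =>
    intro g hg hd
    obtain ⟨M, hM⟩ := ih (per_fderiv hg (Pi.single j 1)) (contDiff_dir hd (Pi.single j 1))
    refine ⟨M, fun k => le_trans ?_ (hM k)⟩
    rw [cf_fderiv hg hd]
    have : Lk k (Pi.single j 1) = k j := by
      rw [Lk_apply]; simp [Pi.single_apply]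
    rw [this, norm_mul, norm_mul, norm_mul, norm_mul]
    simp only [Complex.norm_real, Complex.norm_I, Real.norm_eq_abs, abs_of_pos Real.pi_pos]
    have h3 := Real.pi_gt_three
    have : 0 ≤ |(k j : ℝ)| ^ N * (|(k j : ℝ)| * ‖cf g k‖) := by positivity
    have h2 : ‖(2 : ℂ)‖ = 2 := by simp
    rw [h2, pow_succ]
    nlinarith

def Dec (b : (Fin d → ℤ) → ℂ) : Prop :=
  ∀ N : ℕ, ∃ M : ℝ, ∀ k : Fin d → ℤ, k ≠ 0 → ‖kc k‖ ^ N * ‖b k‖ ≤ M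

lemma exists_max {k : Fin d → ℤ} (hk : k ≠ 0) : ∃ j, ‖kc k‖ = |(k j : ℝ)| := by
  obtain ⟨i, hi⟩ := Function.ne_iff.1 hk
  have : Nonempty (Fin d) := ⟨i⟩
  obtain ⟨j, hj⟩ := Finite.exists_max (fun i => |(k i : ℝ)|)
  refine ⟨j, le_antisymm ?_ (norm_le_pi_norm (kc k) j)⟩
  rw [pi_norm_le_iff_of_nonneg (abs_nonneg _)]
  exact hj

lemma one_le_kc {k : Fin d → ℤ} (hk : k ≠ 0) : 1 ≤ ‖kc k‖ := by
  obtain ⟨i, hi⟩ := Function.ne_iff.1 hk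
  refine le_trans ?_ (norm_le_pi_norm (kc k) i)
  show 1 ≤ |(k i : ℝ)|
  exact_mod_cast Int.one_le_abs hi

lemma dec_cf {g : (Fin d → ℝ) → ℂ} (hg : Per g) (hd : ContDiff ℝ (⊤ : ℕ∞) g) : Dec (cf g) := by
  intro N
  choose M hM using fun j : Fin d => decay1 j N hg hd
  refine ⟨∑ j, |M j|, fun k hk => ?_⟩
  obtain ⟨j, hj⟩ := exists_max hk
  rw [hj]
  exact (hM j k).trans ((le_abs_self _).trans
    (Finset.single_le_sum (f := fun j => |M j|) (fun _ _ => abs_nonneg _) (Finset.mem_univ j)))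

lemma summable_kc : ∃ R : ℕ, Summable fun k : Fin d → ℤ => ‖kc k‖⁻¹ ^ R := by
  let L : Submodule ℤ (Fin d → ℝ) := Submodule.span ℤ (Set.range (Pi.basisFun ℝ (Fin d)))
  refine ⟨Module.finrank ℤ L + 1, ?_⟩
  have h := ZLattice.summable_norm_pow_inv L (Module.finrank ℤ L + 1) (Nat.lt_succ_self _)
  have hm : ∀ k : Fin d → ℤ, kc k ∈ L := by
    intro k
    have : kc k = ∑ i, k i • (Pi.basisFun ℝ (Fin d) i) := by
      ext i
      simp [kc, Finset.sum_apply, Pi.single_apply]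
    rw [this]
    exact Submodule.sum_mem _ fun i _ => Submodule.smul_mem _ _ (Submodule.subset_span ⟨i, rfl⟩)
  have hi : Function.Injective fun k : Fin d → ℤ => (⟨kc k, hm k⟩ : L) := by
    intro k l h
    ext i
    have h1 : kc k = kc l := congrArg Subtype.val h
    have h2 : (k i : ℝ) = l i := congrFun h1 i
    exact_mod_cast h2
  have h3 := h.comp_injective hi
  refine h3.congr fun k => ?_
  rfl

lemma Dec.summable {b : (Fin d → ℤ) → ℂ} (hb : Dec b) (n : ℕ) :
    Summable fun k => ‖kc k‖ ^ n * ‖b k‖ := by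
  obtain ⟨R, hR⟩ := summable_kc (d := d)
  obtain ⟨M, hM⟩ := hb (n + R)
  refine Summable.of_norm_bounded_eventually (hR.mul_left M) ?_
  have : ∀ᶠ k : Fin d → ℤ in Filter.cofinite, k ≠ 0 := by
    simp [Filter.eventually_cofinite]
  filter_upwards [this] with k hk
  have h1 := one_le_kc hk
  have h2 := hM k hk
  rw [Real.norm_of_nonneg (by positivity), inv_pow, ← div_eq_mul_inv, le_div_iff₀ (by positivity)]
  rw [pow_add] at h2
  linarith

noncomputable def ser (b : (Fin d → ℤ) → ℂ) (x : Fin d → ℝ) : ℂ := ∑' k, b k * ch k x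

lemma summable_ser {b : (Fin d → ℤ) → ℂ} (hb : Dec b) (x : Fin d → ℝ) :
    Summable fun k => b k * ch k x := by
  refine Summable.of_norm ?_
  simpa [norm_ch] using hb.summable 0

lemma contDiff_ser {b : (Fin d → ℤ) → ℂ} (hb : Dec b) : ContDiff ℝ (⊤ : ℕ∞) (ser b) := by
  refine contDiff_tsum (v := fun n k => ((2 * Real.pi) ^ n * d ^ n) * (‖kc k‖ ^ n * ‖b k‖))
    (fun k => contDiff_const.mul (contDiff_ch k)) (fun n _ => (hb.summable n).mul_left _) ?_
  intro n k x _
  have : iteratedFDeriv ℝ n (fun x => b k * ch k x) x = b k • iteratedFDeriv ℝ n (ch k) x :=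
    iteratedFDeriv_const_smul_apply (a := b k) (f := ch k) ((contDiff_ch k).of_le (by exact_mod_cast le_top)).contDiffAt
  rw [this, norm_smul]
  have h1 := norm_iter_ch k n x
  have h2 := pow_le_pow_left₀ (norm_nonneg _) (norm_Lk k) n
  rw [mul_pow] at h2
  calc ‖b k‖ * ‖iteratedFDeriv ℝ n (ch k) x‖
      ≤ ‖b k‖ * ((2 * Real.pi) ^ n * (d ^ n * ‖kc k‖ ^ n)) := by
        refine mul_le_mul_of_nonneg_left (h1.trans ?_) (norm_nonneg _)
        exact mul_le_mul_of_nonneg_left h2 (by positivity)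
    _ = _ := by ring

lemma hasFDerivAt_ser {b : (Fin d → ℤ) → ℂ} (hb : Dec b) (x v : Fin d → ℝ) :
    fderiv ℝ (ser b) x v = ∑' k, b k * (2 * Real.pi * Complex.I * (Lk k v)) * ch k x := by
  have hs : Summable fun k => (2 * Real.pi * d) * (‖kc k‖ ^ 1 * ‖b k‖) := (hb.summable 1).mul_left _
  have hbd : ∀ k (x : Fin d → ℝ), ‖b k • (Lk k).smulRight (2 * Real.pi * Complex.I * ch k x)‖ ≤
      (2 * Real.pi * d) * (‖kc k‖ ^ 1 * ‖b k‖) := by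
    intro k x
    rw [norm_smul, ContinuousLinearMap.norm_smulRight_apply]
    have h1 := norm_Lk k
    have : ‖2 * (Real.pi : ℂ) * Complex.I * ch k x‖ = 2 * Real.pi := by
      simp [norm_ch, abs_of_pos Real.pi_pos]
    rw [this]
    have h2 : ‖b k‖ * (‖Lk k‖ * (2 * Real.pi)) ≤ ‖b k‖ * ((d * ‖kc k‖) * (2 * Real.pi)) := by
      gcongr
    linarith
  have h := hasFDerivAt_tsum (𝕜 := ℝ) (f := fun k x => b k * ch k x)
    (f' := fun k x => b k • (Lk k).smulRight (2 * Real.pi * Complex.I * ch k x)) hs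
    (fun k x => (hasFDerivAt_ch k x).const_mul (b k)) hbd (summable_ser hb 0) x
  have h' : HasFDerivAt (ser b) _ x := h
  rw [h'.fderiv]
  have hsum : Summable fun k => b k • (Lk k).smulRight (2 * Real.pi * Complex.I * ch k x) :=
    Summable.of_norm_bounded hs fun k => hbd k x
  have := (ContinuousLinearMap.apply ℝ ℂ v).map_tsum hsum
  simp only [ContinuousLinearMap.apply_apply] at this
  rw [this]
  refine tsum_congr fun k => ?_
  simp
  ring

end DioFlow

theorem diophantine_flow_cohomology_free {d : ℕ} (α : Fin d → ℝ)
    (hdio : ∃ C τ : ℝ, 0 < C ∧ 0 < τ ∧ ∀ k : Fin d → ℤ, k ≠ 0 →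
      C * (((Finset.univ.sup fun i => (k i).natAbs : ℕ) : ℝ)) ^ (-τ) <
        |∑ i, α i * (k i : ℝ)|)
    (ξ : (Fin d → ℝ) → ℝ) (hξ : ContDiff ℝ (⊤ : ℕ∞) ξ)
    (hper : ∀ (θ : Fin d → ℝ) (k : Fin d → ℤ), ξ (θ + fun i => (k i : ℝ)) = ξ θ) :
    ∃ u : (Fin d → ℝ) → ℝ, ContDiff ℝ (⊤ : ℕ∞) u ∧
      (∀ (θ : Fin d → ℝ) (k : Fin d → ℤ), u (θ + fun i => (k i : ℝ)) = u θ) ∧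
      ∀ θ : Fin d → ℝ, fderiv ℝ u θ α =
        ξ θ - ∫ θ' in (Set.univ.pi fun _ : Fin d => Set.Icc (0:ℝ) 1), ξ θ' := by
  open DioFlow in
  obtain ⟨C, τ, hC, hτ, hdio⟩ := hdio
  let g : (Fin d → ℝ) → ℂ := fun x => (ξ x : ℂ)
  have hg : Per g := fun x k => by simp only [g, hper]
  have hgd : ContDiff ℝ (⊤ : ℕ∞) g := Complex.ofRealCLM.contDiff.comp hξ
  have hc := dec_cf hg hgd
  have hlow : ∀ k : Fin d → ℤ, k ≠ 0 → C ≤ ‖kc k‖ ^ ⌈τ⌉₊ * |Lk k α| := by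
    intro k hk
    have h := hdio k hk
    have e1 : ∑ i, α i * (k i : ℝ) = Lk k α := by
      rw [Lk_apply]; exact Finset.sum_congr rfl fun i _ => mul_comm _ _
    have e2 : (((Finset.univ.sup fun i => (k i).natAbs : ℕ) : ℝ)) ≤ ‖kc k‖ := by
      obtain ⟨i, hi⟩ := Function.ne_iff.1 hk
      obtain ⟨j, _, hj⟩ := Finset.exists_mem_eq_sup Finset.univ ⟨i, Finset.mem_univ i⟩
        (fun i => (k i).natAbs)
      rw [hj, Nat.cast_natAbs, Int.cast_abs]
      exact norm_le_pi_norm (kc k) j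
    have e3 : (1 : ℝ) ≤ (((Finset.univ.sup fun i => (k i).natAbs : ℕ) : ℝ)) := by
      obtain ⟨i, hi⟩ := Function.ne_iff.1 hk
      have h1 : (k i).natAbs ≤ Finset.univ.sup fun i => (k i).natAbs :=
        Finset.le_sup (f := fun i => (k i).natAbs) (Finset.mem_univ i)
      have h2 : 1 ≤ (k i).natAbs := Int.natAbs_pos.2 hi
      exact_mod_cast h2.trans h1
    rw [e1] at h
    set S : ℝ := (((Finset.univ.sup fun i => (k i).natAbs : ℕ) : ℝ))
    have hS : 0 < S := by linarith
    rw [Real.rpow_neg hS.le, ← div_eq_mul_inv, div_lt_iff₀ (Real.rpow_pos_of_pos hS _)] at h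
    have h4 : S ^ τ ≤ ‖kc k‖ ^ ⌈τ⌉₊ := by
      calc S ^ τ ≤ S ^ ((⌈τ⌉₊ : ℕ) : ℝ) := Real.rpow_le_rpow_of_exponent_le e3 (Nat.le_ceil τ)
        _ = S ^ ⌈τ⌉₊ := Real.rpow_natCast _ _
        _ ≤ _ := pow_le_pow_left₀ hS.le e2 _
    have := mul_le_mul_of_nonneg_left h4 (abs_nonneg (Lk k α))
    linarith
  let b : (Fin d → ℤ) → ℂ := fun k => cf g k / (2 * Real.pi * Complex.I * (Lk k α))
  have hLne : ∀ k : Fin d → ℤ, k ≠ 0 → Lk k α ≠ 0 := by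
    intro k hk h0
    have := hlow k hk
    rw [h0] at this
    simp at this
    linarith
  have hb : Dec b := by
    intro N
    obtain ⟨M, hM⟩ := hc (N + ⌈τ⌉₊)
    refine ⟨M / C, fun k hk => ?_⟩
    have h1 := hM k hk
    have h2 := hlow k hk
    have h3 : 0 < |Lk k α| := abs_pos.2 (hLne k hk)
    have h4 : ‖b k‖ = ‖cf g k‖ / (2 * Real.pi * |Lk k α|) := by
      simp [b, abs_of_pos Real.pi_pos]
    have h5 : ‖b k‖ * |Lk k α| ≤ ‖cf g k‖ := by
      rw [h4, div_mul_eq_mul_div, div_le_iff₀ (by positivity)]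
      have : 1 * (‖cf g k‖ * |Lk k α|) ≤ (2 * Real.pi) * (‖cf g k‖ * |Lk k α|) := by
        refine mul_le_mul_of_nonneg_right ?_ (by positivity)
        linarith [Real.pi_gt_three]
      linarith
    rw [le_div_iff₀ hC]
    calc ‖kc k‖ ^ N * ‖b k‖ * C ≤ ‖kc k‖ ^ N * ‖b k‖ * (‖kc k‖ ^ ⌈τ⌉₊ * |Lk k α|) := by gcongr
      _ = ‖kc k‖ ^ (N + ⌈τ⌉₊) * (‖b k‖ * |Lk k α|) := by ring
      _ ≤ ‖kc k‖ ^ (N + ⌈τ⌉₊) * ‖cf g k‖ := by gcongr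
      _ ≤ M := h1
  have hsd := contDiff_ser hb
  refine ⟨fun x => (ser b x).re, Complex.reCLM.contDiff.comp hsd, ?_, ?_⟩
  · intro x k
    simp only [ser, ch_periodic]
  intro x
  have hre : fderiv ℝ (fun x => (ser b x).re) x α = (fderiv ℝ (ser b) x α).re := by
    have := Complex.reCLM.hasFDerivAt.comp x (hsd.differentiable (by simp) x).hasFDerivAt
    have h' : HasFDerivAt (fun x => (ser b x).re) _ x := this
    rw [h'.fderiv]
    rfl
  have hcs : Summable (cf g) := by
    refine Summable.of_norm ?_
    simpa using hc.summable 0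
  have hsum := hasSum_cf hg hgd.continuous hcs x
  have hsum2 := hsum.sub (hasSum_ite_eq (0 : Fin d → ℤ) (cf g 0))
  have hterm : ∀ k, b k * (2 * Real.pi * Complex.I * (Lk k α)) * ch k x =
      cf g k * ch k x - if k = 0 then cf g 0 else 0 := by
    intro k
    by_cases hk : k = 0
    · subst hk
      simp [b, ch_zero, Lk_apply]
    · have h1 : (Lk k α : ℂ) ≠ 0 := by exact_mod_cast hLne k hk
      have h2 : (Real.pi : ℂ) ≠ 0 := by exact_mod_cast Real.pi_ne_zero
      rw [if_neg hk, sub_zero]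
      simp only [b]
      rw [div_mul_cancel₀ _ (by simp [h1, h2])]
  rw [hre, hasFDerivAt_ser hb, tsum_congr hterm, hsum2.tsum_eq]
  have hc0 : cf g 0 = ((∫ θ' in (Set.univ.pi fun _ : Fin d => Set.Icc (0:ℝ) 1), ξ θ' : ℝ) : ℂ) := by
    rw [← integral_complex_ofReal]
    simp only [cf, neg_zero, ch_zero, one_mul, g]
    have e1 : box (0 : Fin d → ℝ) = Set.univ.pi fun i => Set.Ioc ((0 : Fin d → ℝ) i) ((1 : Fin d → ℝ) i) := by
      ext y; simp [box]
    have e2 : (Set.univ.pi fun _ : Fin d => Set.Icc (0:ℝ) 1) = Set.Icc (0 : Fin d → ℝ) 1 := by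
      rw [← Set.pi_univ_Icc]; rfl
    rw [e1, e2]
    exact setIntegral_congr_set Measure.univ_pi_Ioc_ae_eq_Icc
  rw [hc0, Complex.sub_re, Complex.ofReal_re]
  simp [g]
end
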